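/- Let k be a field, and let ⪯ and ⊑ be two term orders on k[X₁,…,X_{n+1}] such that X₁ ≺ … ≺ X_{n+1} and X₁ ⊏ … ⊏ X_{n+1}. Let I be an ideal of k[X₁,…,X_{n+1}] such that every axis contained in 𝒟_⪯(I) and every axis contained in 𝒟_⊑(I) is parallel to ℕe₁. Then the number of axes contained in 𝒟_⪯(I) equals the number of axes contained in 𝒟_⊑(I). -/

import Mathlib

open MvPolynomial Finsupp

/-- The total degree `|γ|` of an exponent vector `γ ∈ ℕ^m`. -/
def degOf {m : ℕ} (γ : Fin m →₀ ℕ) : ℕ := γ.sum fun _ e => e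

/-- A term order on `k[X₁,…,X_m]`: a total order on the exponents `ℕ^m`
(equivalently, on monomials) which is compatible with addition (multiplication of
monomials) and has `0` (the monomial `1`) as least element. -/
structure TermOrder (m : ℕ) : Type where
  le : (Fin m →₀ ℕ) → (Fin m →₀ ℕ) → Prop
  le_refl : ∀ a, le a a
  le_trans : ∀ {a b c}, le a b → le b c → le a c
  le_antisymm : ∀ {a b}, le a b → le b a → a = b
  le_total : ∀ a b, le a b ∨ le b a
  add_le_add_right : ∀ {a b} (c), le a b → le (a + c) (b + c)
  zero_le : ∀ a, le 0 a

/-- The statement that `X₁ < X₂ < … < X_m` for a term order on `k[X₁,…,X_m]`. -/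
def TermOrder.VarAsc {m : ℕ} (ord : TermOrder m) : Prop :=
  ∀ i j : Fin m, i < j → ord.le (Finsupp.single i 1) (Finsupp.single j 1)

/-- `σ` is the leading exponent of `f` w.r.t. the order `le` on exponents:
it occurs in `f` with nonzero coefficient and dominates every exponent of `f`. -/
def IsMaxExp {k : Type*} [CommSemiring k] {m : ℕ}
    (le : (Fin m →₀ ℕ) → (Fin m →₀ ℕ) → Prop)
    (f : MvPolynomial (Fin m) k) (σ : Fin m →₀ ℕ) : Prop :=
  σ ∈ f.support ∧ ∀ τ ∈ f.support, le τ σ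

/-- The set `C(S)` of leading exponents of (nonzero) elements of a set `S` of polynomials. -/
def leadExps {k : Type*} [CommSemiring k] {m : ℕ}
    (le : (Fin m →₀ ℕ) → (Fin m →₀ ℕ) → Prop)
    (S : Set (MvPolynomial (Fin m) k)) : Set (Fin m →₀ ℕ) :=
  {σ | ∃ f ∈ S, IsMaxExp le f σ}

/-- `γ <_lex δ`: the strict lexicographic order where `X₁ < … < X_m`, i.e. comparison
is by the *largest* index at which the exponents differ. -/
def lexLt {m : ℕ} (γ δ : Fin m →₀ ℕ) : Prop :=
  ∃ j, γ j < δ j ∧ ∀ i, j < i → γ i = δ i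

/-- The lexicographic order with `X₁ < … < X_m`. -/
def lexLe {m : ℕ} (γ δ : Fin m →₀ ℕ) : Prop := γ = δ ∨ lexLt γ δ

/-- The graded lexicographic order with `X₁ ≺ … ≺ X_m`: compare total degrees first,
break ties lexicographically. -/
def degLexLe {m : ℕ} (γ δ : Fin m →₀ ℕ) : Prop :=
  γ = δ ∨ degOf γ < degOf δ ∨ (degOf γ = degOf δ ∧ lexLt γ δ)

/-- `G` is the reduced Gröbner basis of the ideal `I` w.r.t. the order `le` on exponents:
`G ⊆ I`, `0 ∉ G`, the leading exponent of every nonzero element of `I` is divisible by the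
leading exponent of some `g ∈ G`, every `g ∈ G` is monic, and no monomial occurring in some
`g ∈ G` is divisible by the leading monomial of another element of `G`. -/
structure IsReducedGroebnerBasis {k : Type*} [Field k] {m : ℕ}
    (le : (Fin m →₀ ℕ) → (Fin m →₀ ℕ) → Prop)
    (I : Ideal (MvPolynomial (Fin m) k))
    (G : Finset (MvPolynomial (Fin m) k)) : Prop where
  mem : ∀ g ∈ G, g ∈ I
  ne_zero : ∀ g ∈ G, g ≠ 0
  divides : ∀ f ∈ I, ∀ σ, IsMaxExp le f σ → ∃ g ∈ G, ∃ τ, IsMaxExp le g τ ∧ τ ≤ σ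
  monic : ∀ g ∈ G, ∀ σ, IsMaxExp le g σ → g.coeff σ = 1
  reduced : ∀ g ∈ G, ∀ g' ∈ G, g' ≠ g → ∀ σ ∈ g.support, ∀ τ, IsMaxExp le g' τ → ¬ τ ≤ σ

/-- A line through the origin in `k^m` (through at least one other point). -/
def IsLineThroughOrigin {k : Type*} [Field k] {m : ℕ} (ℓ : Set (Fin m → k)) : Prop :=
  ∃ v : Fin m → k, v ≠ 0 ∧ ℓ = Set.range fun c : k => c • v

/-- The homogenisation `ℋ(f) ∈ k[X₁,…,X_{n+1}]` of `f ∈ k[X₂,…,X_{n+1}]` with respect to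
the extra variable `X₁`: each monomial of `f` is multiplied by the power of `X₁` making
its total degree equal to the total degree of `f`. -/
noncomputable def homog {k : Type*} [CommSemiring k] {n : ℕ}
    (f : MvPolynomial (Fin n) k) : MvPolynomial (Fin (n + 1)) k :=
  f.support.sum fun α =>
    MvPolynomial.monomial
      (Finsupp.single (0 : Fin (n + 1)) (f.totalDegree - degOf α) +
        Finsupp.embDomain (Fin.succEmb n) α)
      (f.coeff α)

/-- The dehomogenisation `h(1, X₂, …, X_{n+1}) ∈ k[X₂,…,X_{n+1}]` of
`h ∈ k[X₁,…,X_{n+1}]`, obtained by substituting `X₁ = 1`. -/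
noncomputable def dehom {k : Type*} [CommSemiring k] {n : ℕ}
    (h : MvPolynomial (Fin (n + 1)) k) : MvPolynomial (Fin n) k :=
  MvPolynomial.aeval (Fin.cases 1 MvPolynomial.X) h

/-- The projection `π : ℕ^{n+1} → ℕ^n` deleting the first coordinate. -/
noncomputable def piProj {n : ℕ} (γ : Fin (n + 1) →₀ ℕ) : Fin n →₀ ℕ :=
  Finsupp.comapDomain Fin.succ γ ((Fin.succ_injective n).injOn)

/-- The embedding `ℕ^n ↪ ℕ^{n+1}`, `α ↦ (0, α)`. -/
noncomputable def embSucc {n : ℕ} (α : Fin n →₀ ℕ) : Fin (n + 1) →₀ ℕ :=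
  Finsupp.embDomain (Fin.succEmb n) α

/-- `L` is the axis `γ + ℕ·e_i` in `ℕ^m` (where `γ_i = 0`), an axis parallel to `ℕ e_i`. -/
def IsAxisThrough {m : ℕ} (L : Set (Fin m →₀ ℕ)) (i : Fin m) (γ : Fin m →₀ ℕ) : Prop :=
  γ i = 0 ∧ L = Set.range fun t : ℕ => γ + Finsupp.single i t

/-- `L` is an axis in `ℕ^m`. -/
def IsAxis {m : ℕ} (L : Set (Fin m →₀ ℕ)) : Prop :=
  ∃ i γ, IsAxisThrough L i γ

theorem TermOrder.le_of_le {m : ℕ} (ord : TermOrder m) {a b : Fin m →₀ ℕ} (h : a ≤ b) :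
    ord.le a b := by
  have := ord.add_le_add_right a (ord.zero_le (b - a))
  rwa [zero_add, tsub_add_cancel_of_le h] at this

theorem TermOrder.wellFounded {m : ℕ} (ord : TermOrder m) :
    WellFounded fun a b => ord.le a b ∧ ¬ ord.le b a := by
  have : IsPreorder (Fin m →₀ ℕ) ord.le :=
    { refl := ord.le_refl, trans := fun _ _ _ => ord.le_trans }
  refine WellQuasiOrdered.wellFounded (r := ord.le) fun f => ?_
  obtain ⟨i, j, hij, h⟩ := wellQuasiOrdered_le f
  exact ⟨i, j, hij, ord.le_of_le h⟩

theorem TermOrder.exists_isMaxExp {k : Type*} [CommSemiring k] {m : ℕ} (ord : TermOrder m)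
    {f : MvPolynomial (Fin m) k} (hf : f ≠ 0) : ∃ σ, IsMaxExp ord.le f σ := by
  have exists_max : ∀ s : Finset (Fin m →₀ ℕ), s.Nonempty → ∃ σ ∈ s, ∀ τ ∈ s, ord.le τ σ := by
    intro s hs
    induction hs using Finset.Nonempty.cons_induction with
    | singleton a => exact ⟨a, by simp, by simp [ord.le_refl]⟩
    | cons a s ha hs ih =>
      obtain ⟨σ, hσ, h⟩ := ih
      rcases ord.le_total a σ with h' | h'
      · exact ⟨σ, by simp [hσ], by simpa using ⟨h', h⟩⟩
      · exact ⟨a, by simp, by simpa using ⟨ord.le_refl a, fun τ hτ => ord.le_trans (h τ hτ) h'⟩⟩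
  exact exists_max _ (by simpa using hf)

theorem add_mem_leadExps {k : Type*} [CommSemiring k] {m : ℕ} (ord : TermOrder m)
    (I : Ideal (MvPolynomial (Fin m) k)) {σ : Fin m →₀ ℕ}
    (hσ : σ ∈ leadExps ord.le (I : Set (MvPolynomial (Fin m) k))) (τ : Fin m →₀ ℕ) :
    σ + τ ∈ leadExps ord.le (I : Set (MvPolynomial (Fin m) k)) := by
  obtain ⟨f, hf, h1, h2⟩ := hσ
  refine ⟨f * monomial τ 1, I.mul_mem_right _ hf, ?_, fun ρ hρ => ?_⟩
  · simpa [MvPolynomial.mem_support_iff, coeff_mul_monomial] using h1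
  · rw [MvPolynomial.mem_support_iff, coeff_mul_monomial'] at hρ
    split_ifs at hρ with hle
    · have := ord.add_le_add_right τ (h2 (ρ - τ) (by simpa using hρ))
      rwa [tsub_add_cancel_of_le hle] at this
    · exact absurd rfl hρ

theorem mem_leadExps_of_le {k : Type*} [CommSemiring k] {m : ℕ} (ord : TermOrder m)
    (I : Ideal (MvPolynomial (Fin m) k)) {σ τ : Fin m →₀ ℕ}
    (hσ : σ ∈ leadExps ord.le (I : Set (MvPolynomial (Fin m) k))) (h : σ ≤ τ) :
    τ ∈ leadExps ord.le (I : Set (MvPolynomial (Fin m) k)) := by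
  simpa [add_tsub_cancel_of_le h] using add_mem_leadExps ord I hσ (τ - σ)

/-- The standard monomials of an ideal are linearly independent modulo the ideal. -/
theorem linearIndependent_standardMonomials {k : Type*} [Field k] {m : ℕ} (ord : TermOrder m)
    (I : Ideal (MvPolynomial (Fin m) k)) :
    LinearIndependent k fun σ : ((leadExps ord.le (I : Set (MvPolynomial (Fin m) k)))ᶜ :
      Set (Fin m →₀ ℕ)) => Ideal.Quotient.mk I (monomial σ.1 1) := by
  rw [linearIndependent_iff]
  intro l hl
  by_contra hne
  set f : MvPolynomial (Fin m) k := l.sum fun σ c => monomial σ.1 c with hf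
  have hfI : f ∈ I := by
    rw [← Ideal.Quotient.eq_zero_iff_mem, ← hl, hf, Finsupp.linearCombination_apply, map_finsuppSum]
    refine Finsupp.sum_congr fun σ _ => ?_
    rw [← Ideal.Quotient.mkₐ_eq_mk k, ← map_smul, smul_monomial, smul_eq_mul, mul_one]
  have hcoeff : ∀ τ, coeff τ f = l.sum fun σ c => if σ.1 = τ then c else 0 := by
    intro τ
    rw [hf, Finsupp.sum, coeff_sum]
    simp [coeff_monomial, Finsupp.sum]
  have hf0 : f ≠ 0 := by
    obtain ⟨σ, hσ⟩ := Finsupp.ne_iff.1 hne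
    intro h0
    apply hσ
    have := hcoeff σ.1
    rw [h0, coeff_zero] at this
    simpa [← Subtype.ext_iff, Finsupp.sum, eq_comm] using this
  obtain ⟨τ, hτ⟩ := ord.exists_isMaxExp hf0
  have h1 := MvPolynomial.mem_support_iff.1 hτ.1
  rw [hcoeff] at h1
  obtain ⟨σ, -, hσ⟩ := Finset.exists_ne_zero_of_sum_ne_zero h1
  have hστ : σ.1 = τ := by
    by_contra h
    simp [h] at hσ
  exact σ.2 ⟨f, hfI, hστ ▸ hτ⟩

/-- The standard monomials of an ideal span the quotient ring. -/
theorem span_standardMonomials {k : Type*} [Field k] {m : ℕ} (ord : TermOrder m)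
    (I : Ideal (MvPolynomial (Fin m) k)) :
    Submodule.span k ((fun σ => Ideal.Quotient.mk I (monomial σ 1)) ''
      (leadExps ord.le (I : Set (MvPolynomial (Fin m) k)))ᶜ) = ⊤ := by
  set S := Submodule.span k ((fun σ => Ideal.Quotient.mk I (monomial σ 1)) ''
      (leadExps ord.le (I : Set (MvPolynomial (Fin m) k)))ᶜ)
  have hsmul : ∀ (σ : Fin m →₀ ℕ) (c : k), Ideal.Quotient.mk I (monomial σ c) =
      c • Ideal.Quotient.mk I (monomial σ 1) := by
    intro σ c
    rw [← Ideal.Quotient.mkₐ_eq_mk k, ← map_smul, smul_monomial, smul_eq_mul, mul_one]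
  have hmon : ∀ σ, Ideal.Quotient.mk I (monomial σ 1) ∈ S := by
    intro σ
    induction σ using ord.wellFounded.induction with
    | _ σ ih =>
      by_cases hσ : σ ∈ leadExps ord.le (I : Set (MvPolynomial (Fin m) k))
      · obtain ⟨f, hf, h1, h2⟩ := hσ
        have hsum : Ideal.Quotient.mk I f = 0 := Ideal.Quotient.eq_zero_iff_mem.2 hf
        rw [f.as_sum, map_sum, ← Finset.add_sum_erase _ _ h1, hsmul] at hsum
        have hrest : ∑ τ ∈ f.support.erase σ,
            Ideal.Quotient.mk I (monomial τ (coeff τ f)) ∈ S := by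
          refine S.sum_mem fun τ hτ => ?_
          rw [hsmul]
          refine S.smul_mem _ (ih τ ⟨h2 τ (Finset.mem_of_mem_erase hτ), fun h => ?_⟩)
          exact Finset.ne_of_mem_erase hτ (ord.le_antisymm (h2 τ (Finset.mem_of_mem_erase hτ)) h)
        rw [← S.smul_mem_iff (MvPolynomial.mem_support_iff.1 h1), eq_neg_of_add_eq_zero_left hsum]
        exact S.neg_mem hrest
      · exact Submodule.subset_span ⟨σ, hσ, rfl⟩
  rw [eq_top_iff]
  rintro x -
  obtain ⟨f, rfl⟩ := Ideal.Quotient.mk_surjective x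
  rw [f.as_sum, map_sum]
  exact S.sum_mem fun τ _ => hsmul τ _ ▸ S.smul_mem _ (hmon τ)


/-- Over `k[X]`, a family whose multiples by powers of `X` are `k`-linearly independent, and
together with a finite set span the whole module over `k`, has as many elements as the rank. -/
theorem finrank_eq_card_of_linearIndependent_of_span {k A ι : Type*} [Field k] [AddCommGroup A]
    [Module k A] [Module (Polynomial k) A] [IsScalarTower k (Polynomial k) A] (b : ι → A)
    (hb : LinearIndependent k fun p : ℕ × ι => (Polynomial.X ^ p.1 : Polynomial k) • b p.2)
    (F : Set A) (hF : F.Finite)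
    (hspan : Submodule.span k
      (Set.range (fun p : ℕ × ι => (Polynomial.X ^ p.1 : Polynomial k) • b p.2) ∪ F) = ⊤) :
    Module.finrank (Polynomial k) A = Nat.card ι := by
  have hli : LinearIndependent (Polynomial k) b := by
    let e := (Polynomial.basisMonomials k).smulTower
      (Finsupp.basisSingleOne (R := Polynomial k) (ι := ι))
    let T := (Finsupp.linearCombination (Polynomial k) b).restrictScalars k
    have hT : T ∘ e = fun p : ℕ × ι => (Polynomial.X ^ p.1 : Polynomial k) • b p.2 := by
      funext p
      simp [T, e, Module.Basis.smulTower_apply, Polynomial.monomial_one_right_eq_X_pow]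
    have hcomp : T = Finsupp.linearCombination k (T ∘ e) ∘ₗ e.repr.toLinearMap :=
      e.ext fun p => by simp
    have hinj : Function.Injective T := by
      rw [hcomp, hT, LinearMap.coe_comp]
      exact Function.Injective.comp hb e.repr.injective
    exact hinj
  set N := Submodule.span (Polynomial k) (Set.range b) with hN
  have hfin : Module.Finite k (A ⧸ N) := by
    let q := N.mkQ.restrictScalars k
    refine ⟨⟨(hF.image q).toFinset, ?_⟩⟩
    rw [Set.Finite.coe_toFinset, eq_top_iff]
    have htop : Submodule.map q ⊤ = ⊤ := by
      rw [Submodule.map_top]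
      exact LinearMap.range_eq_top.2 N.mkQ_surjective
    rw [← htop, ← hspan, Submodule.map_span, Submodule.span_le, Set.image_union,
      Set.union_subset_iff]
    refine ⟨?_, Submodule.subset_span⟩
    rintro _ ⟨_, ⟨p, rfl⟩, rfl⟩
    have : q ((Polynomial.X ^ p.1 : Polynomial k) • b p.2) = 0 :=
      (Submodule.Quotient.mk_eq_zero N).2
        (N.smul_mem _ (Submodule.subset_span (Set.mem_range_self p.2)))
    exact this ▸ Submodule.zero_mem _
  have htors : Module.rank (Polynomial k) (A ⧸ N) = 0 := by
    refine rank_eq_zero_iff.2 fun x => ?_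
    by_contra! h
    have hinj : Function.Injective
        ((LinearMap.toSpanSingleton (Polynomial k) (A ⧸ N) x).restrictScalars k) := by
      rw [injective_iff_map_eq_zero]
      intro p hp
      by_contra hp0
      exact h p hp0 (by simpa using hp)
    have := Module.Finite.of_injective _ hinj
    exact Polynomial.not_finite this
  have hrank := rank_quotient_add_rank_of_isDomain N
  rw [htors, zero_add] at hrank
  rw [Module.finrank, ← hrank, ← Module.finrank, hN,
    Module.finrank_eq_nat_card_basis (Module.Basis.span hli)]

theorem finite_setOf_notMem_of_axis_mem {n : ℕ} (C : Set (Fin (n + 1) →₀ ℕ))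
    (hC : ∀ σ ∈ C, ∀ τ, σ ≤ τ → τ ∈ C)
    (hax : ∀ i : Fin (n + 1), i ≠ 0 → ∃ t : ℕ, Finsupp.single i t ∈ C) :
    {σ | σ ∉ C ∧ ∃ t, σ.erase 0 + Finsupp.single 0 t ∈ C}.Finite := by
  choose! N hN using hax
  have hT : ∀ β : Fin (n + 1) →₀ ℕ, ∃ s : ℕ,
      (∃ t, β + Finsupp.single 0 t ∈ C) → β + Finsupp.single 0 s ∈ C := by
    intro β
    by_cases h : ∃ t, β + Finsupp.single 0 t ∈ C
    · exact ⟨h.choose, fun _ => h.choose_spec⟩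
    · exact ⟨0, fun h' => absurd h' h⟩
  choose T hT using hT
  refine ((Set.finite_Iic (Finsupp.equivFunOnFinite.symm N)).biUnion fun β _ =>
    (Set.finite_Iio (T β)).image fun a => β + Finsupp.single 0 a).subset ?_
  rintro σ ⟨hσ, h⟩
  refine Set.mem_biUnion (x := σ.erase 0) ?_ ⟨σ 0, ?_, Finsupp.erase_add_single 0 σ⟩
  · intro i
    by_cases hi : i = 0
    · simp [hi]
    · rw [Finsupp.erase_ne hi]
      by_contra! hlt
      exact hσ (hC _ (hN i hi) _ (by simpa [Finsupp.single_le_iff] using hlt.le))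
  · by_contra! hle
    refine hσ (hC _ (hT _ h) _ ?_)
    conv_rhs => rw [← Finsupp.erase_add_single 0 σ]
    gcongr
    simpa using hle

theorem ncard_axes_eq_card {n : ℕ} (D : Set (Fin (n + 1) →₀ ℕ))
    (hax : ∀ (L : Set (Fin (n + 1) →₀ ℕ)) (i : Fin (n + 1)) (γ : Fin (n + 1) →₀ ℕ),
      IsAxisThrough L i γ → L ⊆ D → i = 0) :
    {L | IsAxis L ∧ L ⊆ D}.ncard =
      Nat.card {β : Fin (n + 1) →₀ ℕ // β 0 = 0 ∧ ∀ t, β + Finsupp.single 0 t ∈ D} := by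
  have himage : {L | IsAxis L ∧ L ⊆ D} =
      (fun β : Fin (n + 1) →₀ ℕ => Set.range fun t : ℕ => β + Finsupp.single 0 t) ''
        {β | β 0 = 0 ∧ ∀ t, β + Finsupp.single 0 t ∈ D} := by
    ext L
    constructor
    · rintro ⟨⟨i, γ, h⟩, hL⟩
      obtain rfl := hax L i γ h hL
      obtain ⟨hγ, rfl⟩ := h
      exact ⟨γ, ⟨hγ, fun t => hL ⟨t, rfl⟩⟩, rfl⟩
    · rintro ⟨γ, ⟨hγ, h⟩, rfl⟩
      exact ⟨⟨0, γ, hγ, rfl⟩, by rintro _ ⟨t, rfl⟩; exact h t⟩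
  rw [himage, Set.InjOn.ncard_image]
  · exact (Nat.card_coe_set_eq _).symm
  · intro β hβ β' hβ' h
    have hmem : β ∈ Set.range fun t : ℕ => β' + Finsupp.single 0 t :=
      (Set.ext_iff.1 h β).1 ⟨0, by simp⟩
    obtain ⟨t, ht⟩ := hmem
    have ht0 : t = 0 := by simpa [hβ.1, hβ'.1] using DFunLike.congr_fun ht 0
    simpa [ht0] using ht.symm

/-- If all axes of standard exponents are parallel to `ℕe₁`, their number is the rank of the
quotient ring over `k[X₁]`. -/
theorem ncard_axes_eq_finrank {k : Type*} [Field k] {n : ℕ} (ord : TermOrder (n + 1))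
    (I : Ideal (MvPolynomial (Fin (n + 1)) k))
    [Algebra (Polynomial k) (MvPolynomial (Fin (n + 1)) k ⧸ I)]
    [IsScalarTower k (Polynomial k) (MvPolynomial (Fin (n + 1)) k ⧸ I)]
    (hX : algebraMap (Polynomial k) (MvPolynomial (Fin (n + 1)) k ⧸ I) Polynomial.X =
      Ideal.Quotient.mk I (MvPolynomial.X 0))
    (hax : ∀ (L : Set (Fin (n + 1) →₀ ℕ)) (i : Fin (n + 1)) (γ : Fin (n + 1) →₀ ℕ),
      IsAxisThrough L i γ →
        L ⊆ (leadExps ord.le (I : Set (MvPolynomial (Fin (n + 1)) k)))ᶜ → i = 0) :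
    {L | IsAxis L ∧ L ⊆ (leadExps ord.le (I : Set (MvPolynomial (Fin (n + 1)) k)))ᶜ}.ncard =
      Module.finrank (Polynomial k) (MvPolynomial (Fin (n + 1)) k ⧸ I) := by
  set C := leadExps ord.le (I : Set (MvPolynomial (Fin (n + 1)) k))
  rw [ncard_axes_eq_card _ hax]
  have hpow : ∀ (t : ℕ) (β : Fin (n + 1) →₀ ℕ),
      (Polynomial.X ^ t : Polynomial k) • Ideal.Quotient.mk I (monomial β 1) =
        Ideal.Quotient.mk I (monomial (β + Finsupp.single 0 t) 1) := by
    intro t β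
    rw [Algebra.smul_def, map_pow, hX, ← map_pow, ← map_mul, X_pow_eq_monomial, monomial_mul,
      one_mul, add_comm β]
  have hfin := finite_setOf_notMem_of_axis_mem C
    (fun σ hσ τ h => mem_leadExps_of_le ord I hσ h) fun i hi => by
      by_contra! h
      refine hi (hax _ i 0 ⟨rfl, rfl⟩ ?_)
      rintro _ ⟨t, rfl⟩
      simpa using h t
  symm
  refine finrank_eq_card_of_linearIndependent_of_span
    (fun β : {β : Fin (n + 1) →₀ ℕ // β 0 = 0 ∧ ∀ t, β + Finsupp.single 0 t ∈ Cᶜ} =>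
      Ideal.Quotient.mk I (monomial β.1 1)) ?_ _
    (hfin.image fun σ => Ideal.Quotient.mk I (monomial σ 1)) ?_
  · simp_rw [hpow]
    refine (linearIndependent_standardMonomials ord I).comp
      (fun p : ℕ × {β : Fin (n + 1) →₀ ℕ // β 0 = 0 ∧ ∀ t, β + Finsupp.single 0 t ∈ Cᶜ} =>
        ⟨p.2.1 + Finsupp.single 0 p.1, p.2.2.2 p.1⟩) ?_
    rintro ⟨t, β, hβ⟩ ⟨t', β', hβ'⟩ h
    have h' : β + Finsupp.single 0 t = β' + Finsupp.single 0 t' := congrArg Subtype.val h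
    have htt : t = t' := by simpa [hβ.1, hβ'.1] using DFunLike.congr_fun h' 0
    subst htt
    simpa using h'
  · rw [eq_top_iff, ← span_standardMonomials ord I]
    refine Submodule.span_mono ?_
    rintro _ ⟨σ, hσ, rfl⟩
    by_cases h : ∃ t, σ.erase 0 + Finsupp.single 0 t ∈ C
    · exact Or.inr ⟨σ, ⟨hσ, h⟩, rfl⟩
    · push Not at h
      refine Or.inl ⟨⟨σ 0, σ.erase 0, by simp, h⟩, ?_⟩
      simp only [hpow, Finsupp.erase_add_single]

/-- If all axes in `𝒟_⪯(I)` and in `𝒟_⊑(I)` are parallel to `ℕe₁`, then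
the numbers of axes contained in `𝒟_⪯(I)` and in `𝒟_⊑(I)` coincide. -/
theorem statement_12 {k : Type*} [Field k] {n : ℕ}
    (ord₁ ord₂ : TermOrder (n + 1)) (hvar₁ : ord₁.VarAsc) (hvar₂ : ord₂.VarAsc)
    (I : Ideal (MvPolynomial (Fin (n + 1)) k))
    (D₁ D₂ : Set (Fin (n + 1) →₀ ℕ))
    (hD₁ : D₁ = (leadExps ord₁.le (I : Set (MvPolynomial (Fin (n + 1)) k)))ᶜ)
    (hD₂ : D₂ = (leadExps ord₂.le (I : Set (MvPolynomial (Fin (n + 1)) k)))ᶜ)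
    (hax₁ : ∀ (L : Set (Fin (n + 1) →₀ ℕ)) (i : Fin (n + 1)) (γ : Fin (n + 1) →₀ ℕ),
      IsAxisThrough L i γ → L ⊆ D₁ → i = 0)
    (hax₂ : ∀ (L : Set (Fin (n + 1) →₀ ℕ)) (i : Fin (n + 1)) (γ : Fin (n + 1) →₀ ℕ),
      IsAxisThrough L i γ → L ⊆ D₂ → i = 0) :
    {L | IsAxis L ∧ L ⊆ D₁}.ncard = {L | IsAxis L ∧ L ⊆ D₂}.ncard := by
  subst hD₁ hD₂
  let φ : Polynomial k →ₐ[k] MvPolynomial (Fin (n + 1)) k ⧸ I :=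
    Polynomial.aeval (Ideal.Quotient.mk I (MvPolynomial.X 0))
  let : Algebra (Polynomial k) (MvPolynomial (Fin (n + 1)) k ⧸ I) := φ.toRingHom.toAlgebra
  have : IsScalarTower k (Polynomial k) (MvPolynomial (Fin (n + 1)) k ⧸ I) :=
    IsScalarTower.of_algebraMap_eq fun c => (φ.commutes c).symm
  have hX : algebraMap (Polynomial k) (MvPolynomial (Fin (n + 1)) k ⧸ I) Polynomial.X =
      Ideal.Quotient.mk I (MvPolynomial.X 0) := Polynomial.aeval_X _
  rw [ncard_axes_eq_finrank ord₁ I hX hax₁, ncard_axes_eq_finrank ord₂ I hX hax₂]
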